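/- arXiv:1506.03684 — 2 statements merged into one kernel-verified Lean document; each statement's English description precedes it below -/
import Mathlib

section
/- There is a universal constant c > 0 such that for all integers n ≥ 1 and t ≥ 1 and every fixed strict total order ≻ on {1,…,n}, the pseudo-dimension of the class of functions {Rev_A : A is a t-level single-item auction for n bidders with tie-breaking order ≻}, viewed as real-valued functions on ℝⁿ, is at most c·n·t·ln(n·t + 2). -/
open MeasureTheory
open scoped ENNReal

attribute [local instance] Classical.propDecidable

/-- A `t`-level single-item auction for `n` bidders: nondecreasing thresholds
`thr i 0 ≤ thr i 1 ≤ … ≤ thr i (t-1)` for each bidder `i`. -/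
structure TLevel (n t : ℕ) where
  thr : Fin n → Fin t → ℝ
  mono : ∀ i, Monotone (thr i)

namespace TLevel

/-- The level of a bid `b` for bidder `i`: the largest index `τ` with `thr i τ ≤ b`,
or `-1` if no threshold is met (computed as the number of met thresholds minus one,
which coincides with the largest met index since the thresholds are nondecreasing). -/
noncomputable def level {n t : ℕ} (A : TLevel n t) (i : Fin n) (b : ℝ) : ℤ :=
  ((Finset.univ.filter fun τ : Fin t => A.thr i τ ≤ b).card : ℤ) - 1

/-- Bidder `i` wins: her level is ≥ 0 and she beats every other bidder, either by a
strictly higher level or by the tie-breaking order `succ` at equal levels. -/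
def wins {n t : ℕ} (A : TLevel n t) (succ : Fin n → Fin n → Prop)
    (v : Fin n → ℝ) (i : Fin n) : Prop :=
  0 ≤ A.level i (v i) ∧ ∀ j : Fin n, j ≠ i →
    (A.level j (v j) < A.level i (v i) ∨
      (A.level j (v j) = A.level i (v i) ∧ succ i j))

/-- The winner's payment: the infimum over bids at which she would still win. -/
noncomputable def payment {n t : ℕ} (A : TLevel n t) (succ : Fin n → Fin n → Prop)
    (v : Fin n → ℝ) (i : Fin n) : ℝ :=
  sInf {b : ℝ | A.wins succ (Function.update v i b) i}

/-- The revenue of the auction on profile `v`: the winner (if any) pays her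
critical bid; losers pay nothing. -/
noncomputable def Rev {n t : ℕ} (A : TLevel n t) (succ : Fin n → Fin n → Prop)
    (v : Fin n → ℝ) : ℝ :=
  ∑ i : Fin n, if A.wins succ v i then A.payment succ v i else 0

end TLevel

/-- Pseudo-shattering of points `x` by a class `C` of real-valued functions. -/
def PseudoShatters {Q : Type*} (C : Set (Q → ℝ)) {m : ℕ} (x : Fin m → Q) : Prop :=
  ∃ r : Fin m → ℝ, ∀ T : Finset (Fin m), ∃ f ∈ C,
    (∀ j, j ∈ T → r j ≤ f (x j)) ∧ (∀ j, j ∉ T → f (x j) < r j)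

namespace TLevel

variable {n t : ℕ}

lemma le_level_iff (A : TLevel n t) (i : Fin n) (b : ℝ) (τ : Fin t) :
    ((τ : ℕ) : ℤ) ≤ A.level i b ↔ A.thr i τ ≤ b := by
  unfold level
  constructor
  · intro h
    by_contra hb
    have hsub : (Finset.univ.filter fun σ : Fin t => A.thr i σ ≤ b) ⊆ Finset.Iio τ := by
      intro σ hσ
      rw [Finset.mem_filter] at hσ
      rw [Finset.mem_Iio]
      by_contra hle
      exact hb ((A.mono i (not_lt.mp hle)).trans hσ.2)
    have hcard := Finset.card_le_card hsub
    rw [Fin.card_Iio] at hcard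
    omega
  · intro h
    have hsub : Finset.Iic τ ⊆ (Finset.univ.filter fun σ : Fin t => A.thr i σ ≤ b) := by
      intro σ hσ
      rw [Finset.mem_Iic] at hσ
      exact Finset.mem_filter.mpr ⟨Finset.mem_univ _, (A.mono i hσ).trans h⟩
    have hcard := Finset.card_le_card hsub
    rw [Fin.card_Iic] at hcard
    omega

lemma level_lt (A : TLevel n t) (i : Fin n) (b : ℝ) : A.level i b < t := by
  have h := Finset.card_le_univ (Finset.univ.filter fun σ : Fin t => A.thr i σ ≤ b)
  rw [Fintype.card_fin] at h
  unfold level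
  omega

/-- Level `l` is winning for bidder `i` when each other bidder `j` has level `L j`. -/
def Beats (succ : Fin n → Fin n → Prop) (L : Fin n → ℤ) (i : Fin n) (l : ℤ) : Prop :=
  0 ≤ l ∧ ∀ j : Fin n, j ≠ i → (L j < l ∨ (L j = l ∧ succ i j))

lemma Beats.mono {succ : Fin n → Fin n → Prop} {L : Fin n → ℤ} {i : Fin n} {l l' : ℤ}
    (h : Beats succ L i l) (hl : l ≤ l') : Beats succ L i l' := by
  refine ⟨h.1.trans hl, fun j hj => ?_⟩
  rcases h.2 j hj with h1 | ⟨h1, h2⟩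
  · exact Or.inl (h1.trans_le hl)
  · rcases hl.lt_or_eq with h3 | h3
    · exact Or.inl (h1.trans_lt h3)
    · exact Or.inr ⟨h1.trans h3, h2⟩

lemma Beats.exists_minimal {succ : Fin n → Fin n → Prop} {L : Fin n → ℤ} {i : Fin n} {l : ℤ}
    (h : Beats succ L i l) (hl : l < t) :
    ∃ τ : Fin t, ∀ l' : ℤ, Beats succ L i l' ↔ ((τ : ℕ) : ℤ) ≤ l' := by
  obtain ⟨k, rfl⟩ := Int.eq_ofNat_of_zero_le h.1
  have hex : ∃ k : ℕ, Beats succ L i k := ⟨k, h⟩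
  have hmin := Nat.find_min' hex h
  refine ⟨⟨Nat.find hex, by omega⟩, fun l' => ⟨fun hb => ?_, (Nat.find_spec hex).mono⟩⟩
  obtain ⟨k', rfl⟩ := Int.eq_ofNat_of_zero_le hb.1
  exact_mod_cast Nat.find_min' hex hb

lemma wins_update_iff (A : TLevel n t) (succ : Fin n → Fin n → Prop) (v : Fin n → ℝ)
    (i : Fin n) (b : ℝ) :
    A.wins succ (Function.update v i b) i ↔
      Beats succ (fun j => A.level j (v j)) i (A.level i b) := by
  unfold wins Beats
  rw [Function.update_self]
  refine and_congr_right fun _ => forall_congr' fun j => imp_congr_right fun hj => ?_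
  rw [Function.update_of_ne hj]

lemma payment_eq_thr (A : TLevel n t) (succ : Fin n → Fin n → Prop) (v : Fin n → ℝ)
    (i : Fin n) (τ : Fin t)
    (hτ : ∀ l : ℤ, Beats succ (fun j => A.level j (v j)) i l ↔ ((τ : ℕ) : ℤ) ≤ l) :
    A.payment succ v i = A.thr i τ := by
  have hset : {b : ℝ | A.wins succ (Function.update v i b) i} = Set.Ici (A.thr i τ) := by
    ext b
    rw [Set.mem_ofPred_eq, wins_update_iff, hτ, le_level_iff, Set.mem_Ici]
  rw [payment, hset, csInf_Ici]

lemma wins_unique (A : TLevel n t) {succ : Fin n → Fin n → Prop}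
    (hs : IsStrictTotalOrder (Fin n) succ) {v : Fin n → ℝ} {i j : Fin n}
    (hi : A.wins succ v i) (hj : A.wins succ v j) : j = i := by
  by_contra hne
  rcases hi.2 j hne with h1 | ⟨h1, h1'⟩ <;> rcases hj.2 i (Ne.symm hne) with h2 | ⟨h2, h2'⟩
  · omega
  · omega
  · omega
  · exact hs.irrefl i (hs.trans _ _ _ h1' h2')

lemma Rev_eq_payment (A : TLevel n t) {succ : Fin n → Fin n → Prop}
    (hs : IsStrictTotalOrder (Fin n) succ) {v : Fin n → ℝ} {i : Fin n}
    (hi : A.wins succ v i) : A.Rev succ v = A.payment succ v i := by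
  unfold Rev
  rw [Finset.sum_eq_single i, if_pos hi]
  · exact fun j _ hj => if_neg fun h => hj (A.wins_unique hs hi h)
  · exact fun h => absurd (Finset.mem_univ i) h

lemma Rev_eq_zero (A : TLevel n t) {succ : Fin n → Fin n → Prop} {v : Fin n → ℝ}
    (h : ∀ i, ¬ A.wins succ v i) : A.Rev succ v = 0 :=
  Finset.sum_eq_zero fun i _ => if_neg (h i)

/-- Whether the revenue reaches `r` depends only on how the thresholds compare with the bids
and with `r`. -/
lemma le_Rev_iff_of_same_comparisons {A B : TLevel n t} {succ : Fin n → Fin n → Prop}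
    (hs : IsStrictTotalOrder (Fin n) succ) {v : Fin n → ℝ} {r : ℝ}
    (hv : ∀ i τ, A.thr i τ ≤ v i ↔ B.thr i τ ≤ v i)
    (hr : ∀ i τ, r ≤ A.thr i τ ↔ r ≤ B.thr i τ) :
    r ≤ A.Rev succ v ↔ r ≤ B.Rev succ v := by
  have hlev : ∀ i, A.level i (v i) = B.level i (v i) := fun i => by simp only [level, hv]
  have hwins : ∀ i, A.wins succ v i ↔ B.wins succ v i := fun i => by simp only [wins, hlev]
  by_cases h : ∃ i, A.wins succ v i
  · obtain ⟨i, hi⟩ := h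
    have hbeats : Beats succ (fun j => A.level j (v j)) i (A.level i (v i)) := hi
    obtain ⟨τ, hτ⟩ := hbeats.exists_minimal (A.level_lt i (v i))
    rw [A.Rev_eq_payment hs hi, B.Rev_eq_payment hs ((hwins i).mp hi),
      A.payment_eq_thr succ v i τ hτ,
      B.payment_eq_thr succ v i τ (by simpa only [← hlev] using hτ), hr]
  · have hA : ∀ i, ¬ A.wins succ v i := not_exists.mp h
    rw [A.Rev_eq_zero hA, B.Rev_eq_zero fun i hi => hA i ((hwins i).mpr hi)]

end TLevel

/-- The number of indices `j` with `a ≤ w j`. -/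
noncomputable def countGE {m : ℕ} (w : Fin m → ℝ) (a : ℝ) : Fin (m + 1) :=
  ⟨(Finset.univ.filter fun j => a ≤ w j).card,
    Nat.lt_succ_of_le (by simpa using Finset.card_le_univ (Finset.univ.filter fun j => a ≤ w j))⟩

lemma le_iff_of_countGE_eq {m : ℕ} {w : Fin m → ℝ} {a b : ℝ}
    (h : countGE w a = countGE w b) (j : Fin m) : a ≤ w j ↔ b ≤ w j := by
  wlog hab : a ≤ b generalizing a b
  · exact (this h.symm (le_of_not_ge hab)).symm
  have hsub : (Finset.univ.filter fun j => b ≤ w j) ⊆ Finset.univ.filter fun j => a ≤ w j :=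
    Finset.monotone_filter_right _ fun j _ hj => hab.trans hj
  have heq := Finset.eq_of_subset_of_card_le hsub (Fin.ext_iff.mp h).le
  simpa using (Finset.ext_iff.mp heq j).symm

lemma two_pow_le_of_pseudoShatters {n t m : ℕ} {succ : Fin n → Fin n → Prop}
    (hs : IsStrictTotalOrder (Fin n) succ) {v : Fin m → Fin n → ℝ}
    (h : PseudoShatters {g | ∃ A : TLevel n t, g = A.Rev succ} v) :
    2 ^ m ≤ (m + 1) ^ (2 * (n * t)) := by
  obtain ⟨r, hr⟩ := h
  have hA : ∀ T : Finset (Fin m), ∃ A : TLevel n t, ∀ j, j ∈ T ↔ r j ≤ A.Rev succ (v j) := by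
    intro T
    obtain ⟨_, ⟨A, rfl⟩, h1, h2⟩ := hr T
    exact ⟨A, fun j => ⟨h1 j, fun h => by_contra fun hj => (h2 j hj).not_ge h⟩⟩
  choose A hA using hA
  let code : Finset (Fin m) → (Fin n × Fin t → Fin (m + 1) × Fin (m + 1)) := fun T p =>
    (countGE (fun j => v j p.1) ((A T).thr p.1 p.2), countGE (fun j => -r j) (-(A T).thr p.1 p.2))
  have hinj : Function.Injective code := by
    intro S T hST
    ext j
    rw [hA, hA]
    refine TLevel.le_Rev_iff_of_same_comparisons hs (fun i τ => ?_) fun i τ => ?_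
    · exact le_iff_of_countGE_eq (Prod.ext_iff.mp (congrFun hST (i, τ))).1 j
    · simpa using le_iff_of_countGE_eq (Prod.ext_iff.mp (congrFun hST (i, τ))).2 j
  have hcard := Fintype.card_le_of_injective code hinj
  simpa [← pow_two, ← pow_mul] using hcard

lemma le_mul_log_of_two_pow_le {m k : ℕ} (hk : 1 ≤ k) (h : 2 ^ m ≤ (m + 1) ^ (2 * k)) :
    (m : ℝ) ≤ 20 * k * Real.log (k + 2) := by
  have hk' : (1 : ℝ) ≤ k := by exact_mod_cast hk
  have hm : (0 : ℝ) ≤ m := m.cast_nonneg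
  have hlog : (m : ℝ) * Real.log 2 ≤ 2 * k * Real.log (m + 1) := by
    have h' : (2 : ℝ) ^ m ≤ ((m : ℝ) + 1) ^ (2 * k) := by exact_mod_cast h
    have := Real.log_le_log (by positivity) h'
    rw [Real.log_pow, Real.log_pow] at this
    exact_mod_cast this
  have htangent : Real.log (m + 1) ≤ (m + 1) / (8 * k) - 1 + Real.log (8 * k) := by
    have := Real.log_le_sub_one_of_pos (x := ((m : ℝ) + 1) / (8 * k)) (by positivity)
    rw [Real.log_div (by positivity) (by positivity)] at this
    linarith
  have hlog8 : Real.log (8 * k) ≤ 4 * Real.log (k + 2) := by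
    have h4 : 4 * Real.log ((k : ℝ) + 2) = Real.log (((k : ℝ) + 2) ^ 4) := by
      rw [Real.log_pow]; norm_num
    rw [h4]
    refine Real.log_le_log (by positivity) ?_
    have : (0 : ℝ) ≤ k := by positivity
    nlinarith [pow_nonneg this 2, pow_nonneg this 3, pow_nonneg this 4]
  have hmul : 2 * (k : ℝ) * Real.log (m + 1) ≤
      2 * k * ((m + 1) / (8 * k) - 1 + 4 * Real.log (k + 2)) :=
    mul_le_mul_of_nonneg_left (by linarith) (by positivity)
  have hexpand : 2 * (k : ℝ) * ((m + 1) / (8 * k) - 1 + 4 * Real.log (k + 2)) =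
      (m + 1) / 4 - 2 * k + 8 * k * Real.log (k + 2) := by
    field_simp
    ring
  nlinarith [Real.log_two_gt_d9]

/-- There is a universal constant `c > 0` such that for all `n, t ≥ 1` and every strict
total tie-breaking order `succ` on the bidders, the pseudo-dimension of the class of
revenue functions of `t`-level single-item auctions for `n` bidders is at most
`c · n · t · ln(n·t + 2)`: no sequence of more than that many valuation profiles can be
pseudo-shattered. -/
theorem pseudoDim_tlevel_single_item :
    ∃ c : ℝ, 0 < c ∧
      ∀ n t : ℕ, 1 ≤ n → 1 ≤ t →
      ∀ succ : Fin n → Fin n → Prop, IsStrictTotalOrder (Fin n) succ →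
      ∀ (m : ℕ) (v : Fin m → (Fin n → ℝ)),
        PseudoShatters {g | ∃ A : TLevel n t, g = A.Rev succ} v →
        (m : ℝ) ≤ c * n * t * Real.log (n * t + 2) := by
  refine ⟨20, by norm_num, fun n t hn ht succ hs m v h => ?_⟩
  have := le_mul_log_of_two_pow_le (Nat.mul_pos hn ht) (two_pow_le_of_pseudoShatters hs h)
  push_cast at this
  linarith
end

section
/- There is a universal constant c > 0 with the following property. Let n ≥ 1 be an integer, H ≥ 1, ε ∈ (0,1), and let F = F₁ ⊗ … ⊗ F_n be a product probability measure on ℝⁿ whose marginals F_i are atomless and supported in [1,H]. Then for every integer t ≥ c·(1/ε + ln(H)/ln(1+ε)) and every strict total order ≻ on {1,…,n}, there exists a t-level single-item auction A with tie-breaking order ≻ such that E_{v∼F}[Rev_A(v)] ≥ (1−ε)·OPT(F). -/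
open MeasureTheory
open scoped ENNReal

attribute [local instance] Classical.propDecidable

/-- A deterministic DSIC-IR single-item auction for `n` bidders with valuations in `V`:
a measurable 0/1 allocation awarding at most one item, and measurable nonnegative payments
bounded by value times allocation, such that truthful bidding is a dominant strategy. -/
structure SIAuction (n : ℕ) (V : Set ℝ) where
  alloc : (Fin n → ℝ) → Fin n → ℝ
  pay : (Fin n → ℝ) → Fin n → ℝ
  alloc_meas : ∀ i, Measurable fun v => alloc v i
  pay_meas : ∀ i, Measurable fun v => pay v i
  alloc01 : ∀ v i, alloc v i = 0 ∨ alloc v i = 1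
  feas : ∀ v, (∑ i, alloc v i) ≤ 1
  pay_nonneg : ∀ v i, 0 ≤ pay v i
  pay_le : ∀ v, (∀ j, v j ∈ V) → ∀ i, pay v i ≤ v i * alloc v i
  dsic : ∀ v : Fin n → ℝ, (∀ j, v j ∈ V) → ∀ (i : Fin n) (b : ℝ), b ∈ V →
    v i * alloc (Function.update v i b) i - pay (Function.update v i b) i ≤
      v i * alloc v i - pay v i

/-- `OPT n V F`: the supremum of expected revenue over all DSIC-IR single-item
auctions with valuations in `V`, for bid distribution `F`. -/
noncomputable def OPT (n : ℕ) (V : Set ℝ) (F : Measure (Fin n → ℝ)) : ℝ≥0∞ :=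
  ⨆ A : SIAuction n V, ∫⁻ v, ∑ i, ENNReal.ofReal (A.pay v i) ∂F

/-- The survival function of an atomless finite measure is continuous. -/
lemma continuous_measureReal_Ici (μ : Measure ℝ) [IsFiniteMeasure μ] [NullSingletonClass μ] :
    Continuous fun p => μ.real (Set.Ici p) := by
  rw [continuous_iff_continuousAt]
  intro p
  refine (ENNReal.tendsto_toReal (measure_ne_top _ _)).comp ?_
  refine tendsto_measure_of_ae_tendsto_indicator_of_isFiniteMeasure (nhds p) measurableSet_Ici
    (fun _ => measurableSet_Ici) ?_
  have hne : ∀ᵐ b ∂μ, b ≠ p := by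
    simp [ae_iff]
  filter_upwards [hne] with b hb
  rcases lt_or_gt_of_ne hb with h | h
  · filter_upwards [lt_mem_nhds h] with q hq
    simp [not_le.2 hq, not_le.2 h]
  · filter_upwards [gt_mem_nhds h] with q hq
    simp [hq.le, h.le]

section Survival

variable {μ : Measure ℝ} [IsProbabilityMeasure μ] {H : ℝ}

lemma ae_mem_Icc_of_measure_eq_one (hμ : μ (Set.Icc 1 H) = 1) : ∀ᵐ b ∂μ, b ∈ Set.Icc 1 H := by
  rw [← prob_compl_eq_zero_iff measurableSet_Icc] at hμ
  exact hμ

lemma measureReal_Ici_eq_one (hμ : μ (Set.Icc 1 H) = 1) {q : ℝ} (hq : q ≤ 1) :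
    μ.real (Set.Ici q) = 1 := by
  have h : μ (Set.Ici q) = 1 := by
    rw [← prob_compl_eq_zero_iff measurableSet_Ici]
    refine measure_mono_null ?_ (ae_iff.1 (ae_mem_Icc_of_measure_eq_one hμ))
    intro b hb hb'
    exact hb (hq.trans hb'.1)
  simp [measureReal_def, h]

lemma measureReal_Ici_eq_zero [NullSingletonClass μ] (hμ : μ (Set.Icc 1 H) = 1) {q : ℝ}
    (hq : H ≤ q) :
    μ.real (Set.Ici q) = 0 := by
  have h : μ (Set.Ici q) = 0 := by
    have hne : ∀ᵐ b ∂μ, b ≠ q := by simp [ae_iff]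
    refine measure_mono_null ?_ (ae_iff.1 ((ae_mem_Icc_of_measure_eq_one hμ).and hne))
    intro b hb hb'
    exact hb'.2 (le_antisymm (hb'.1.2.trans hq) hb)
  simp [measureReal_def, h]

/-- Optimal posted prices for a nondecreasing sequence of opportunity costs can be chosen
nondecreasing. -/
lemma exists_monotone_optimal_prices [NullSingletonClass μ] (hH : 1 ≤ H) (hμ : μ (Set.Icc 1 H) = 1)
    {s : ℕ → ℝ} (hs : Monotone s) :
    ∃ p : ℕ → ℝ, Monotone p ∧ (∀ k, p k ∈ Set.Icc 1 H) ∧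
      ∀ k q, (q - s k) * μ.real (Set.Ici q) ≤ (p k - s k) * μ.real (Set.Ici (p k)) := by
  have key : ∀ c : ℝ, ∃ p ∈ Set.Icc 1 H,
      (∀ q, (q - c) * μ.real (Set.Ici q) ≤ (p - c) * μ.real (Set.Ici p)) ∧
      ∀ r ∈ Set.Icc 1 H, (p - c) * μ.real (Set.Ici p) ≤ (r - c) * μ.real (Set.Ici r) → r ≤ p := by
    intro c
    set f : ℝ → ℝ := fun q => (q - c) * μ.real (Set.Ici q) with hf
    have hfc : Continuous f :=
      (continuous_id.sub continuous_const).mul (continuous_measureReal_Ici μ)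
    obtain ⟨m, hm, hmax⟩ := (isCompact_Icc (a := (1 : ℝ)) (b := H)).exists_isMaxOn
      ⟨1, le_rfl, hH⟩ hfc.continuousOn
    have hmax' : ∀ q, f q ≤ f m := by
      intro q
      rcases le_total q 1 with h1 | h1
      · refine le_trans ?_ (hmax (⟨le_rfl, hH⟩ : (1 : ℝ) ∈ Set.Icc 1 H))
        simp only [hf, measureReal_Ici_eq_one hμ h1, measureReal_Ici_eq_one hμ le_rfl]
        linarith
      rcases le_total q H with h2 | h2
      · exact hmax ⟨h1, h2⟩
      · refine le_trans ?_ (hmax (⟨hH, le_rfl⟩ : H ∈ Set.Icc 1 H))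
        simp only [hf, measureReal_Ici_eq_zero hμ h2, measureReal_Ici_eq_zero hμ le_rfl]
        simp
    have hcomp : IsCompact (Set.Icc 1 H ∩ {x | f m ≤ f x}) :=
      isCompact_Icc.inter_right (isClosed_le continuous_const hfc)
    obtain ⟨p, hp, hpg⟩ := hcomp.exists_isGreatest ⟨m, hm, le_refl (f m)⟩
    exact ⟨p, hp.1, fun q => (hmax' q).trans hp.2,
      fun r hr hpr => hpg ⟨hr, le_trans hp.2 hpr⟩⟩
  choose P hP hopt hgr using key
  refine ⟨fun k => P (s k), ?_, fun k => hP _, fun k q => hopt _ q⟩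
  intro k l hkl
  by_contra! hlt
  have h1 := hopt (s k) (P (s l))
  have h2 : (P (s k) - s l) * μ.real (Set.Ici (P (s k))) <
      (P (s l) - s l) * μ.real (Set.Ici (P (s l))) := by
    by_contra! h
    exact absurd (hgr (s l) _ (hP _) h) (not_le.2 hlt)
  have h3 : μ.real (Set.Ici (P (s k))) ≤ μ.real (Set.Ici (P (s l))) :=
    measureReal_mono (Set.Ici_subset_Ici.2 hlt.le)
  nlinarith [hs hkl]

end Survival

/-- Telescoping upper bound on the revenue of a posted price `θ`. -/
lemma mul_le_sum_of_optimal_prices {G : ℝ → ℝ} (hG : Antitone G) {p s : ℕ → ℝ}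
    (hs : Monotone s) (hs0 : s 0 = 0)
    (hopt : ∀ k q, (q - s k) * G q ≤ (p k - s k) * G (p k)) {t : ℕ}
    (hend : ∀ q, (q - s t) * G q ≤ 0) (θ : ℝ) :
    θ * G θ ≤ ∑ k ∈ Finset.range t, (s (k + 1) - s k) * G (max (p k) θ) := by
  have key : ∀ m, ∃ q, θ ≤ q ∧
      θ * G θ ≤ ∑ k ∈ Finset.range m, (s (k + 1) - s k) * G (max (p k) θ) + (q - s m) * G q := by
    intro m
    induction m with
    | zero => exact ⟨θ, le_rfl, by simp [hs0]⟩
    | succ m ih =>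
      obtain ⟨q, hq, h⟩ := ih
      rw [Finset.sum_range_succ]
      have hd : 0 ≤ s (m + 1) - s m := sub_nonneg.2 (hs m.le_succ)
      rcases le_total θ (p m) with hp | hp
      · refine ⟨p m, hp, ?_⟩
        rw [max_eq_left hp]
        linarith [hopt m q]
      · refine ⟨q, hq, ?_⟩
        rw [max_eq_right hp]
        nlinarith [hG hq]
  obtain ⟨q, -, h⟩ := key t
  linarith [hend q]

/-- Telescoping lower bound on the revenue of the optimal price `p k`. -/
lemma sum_le_mul_of_optimal_prices {G : ℝ → ℝ} {p s : ℕ → ℝ}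
    (hp : Monotone p) (hs0 : s 0 = 0)
    (hopt : ∀ k q, (q - s k) * G q ≤ (p k - s k) * G (p k)) {H : ℝ} (hH : G H = 0)
    {k t : ℕ} (hk : k < t) :
    ∑ l ∈ Finset.range (t - 1), (s (l + 1) - s l) * G (max (p (l + 1)) (p k)) ≤
      p k * G (p k) := by
  have key : ∀ m, ∑ l ∈ Finset.range m, (s (l + 1) - s l) * G (max (p (l + 1)) (p k)) +
      (max (p m) (p k) - s m) * G (max (p m) (p k)) ≤ p k * G (p k) := by
    intro m
    induction m with
    | zero => simp [hs0, hp (Nat.zero_le k)]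
    | succ m ih =>
      rw [Finset.sum_range_succ]
      rcases le_or_gt k m with h | h
      · rw [max_eq_left (hp h)] at ih
        linarith [hopt m (max (p (m + 1)) (p k))]
      · rw [max_eq_right (hp h.le)] at ih
        rw [max_eq_right (hp (Nat.succ_le_of_lt h))]
        linarith
  have h := key (t - 1)
  rw [max_eq_left (hp (by omega : k ≤ t - 1))] at h
  have h' := hopt (t - 1) H
  rw [hH, mul_zero] at h'
  linarith

/-- The number of thresholds among `p 0, …, p (t - 1)` met by the bid `b`. -/
noncomputable def metCount (p : ℕ → ℝ) (t : ℕ) (b : ℝ) : ℕ :=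
  (Finset.univ.filter fun τ : Fin t => p τ ≤ b).card

lemma metCount_le (p : ℕ → ℝ) (t : ℕ) (b : ℝ) : metCount p t b ≤ t :=
  (Finset.card_le_univ _).trans (by simp)

lemma lt_metCount_iff {p : ℕ → ℝ} (hp : Monotone p) {t k : ℕ} (hk : k < t) {b : ℝ} :
    k < metCount p t b ↔ p k ≤ b := by
  constructor
  · intro h
    by_contra! hb
    have hsub : (Finset.univ.filter fun τ : Fin t => p τ ≤ b) ⊆ Finset.Iio ⟨k, hk⟩ := by
      intro τ hτ
      rw [Finset.mem_filter] at hτ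
      rw [Finset.mem_Iio]
      exact Fin.mk_lt_of_lt_val (hp.reflect_lt (hτ.2.trans_lt hb))
    have := Finset.card_le_card hsub
    rw [Fin.card_Iio] at this
    exact absurd h (not_lt.2 this)
  · intro h
    have hsub : Finset.Iic (⟨k, hk⟩ : Fin t) ⊆ Finset.univ.filter fun τ : Fin t => p τ ≤ b := by
      intro τ hτ
      rw [Finset.mem_Iic] at hτ
      rw [Finset.mem_filter]
      exact ⟨Finset.mem_univ _, (hp hτ).trans h⟩
    have := Finset.card_le_card hsub
    rw [Fin.card_Iic] at this
    exact this

lemma measurable_metCount (p : ℕ → ℝ) (t : ℕ) : Measurable (metCount p t) := by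
  refine Monotone.measurable fun a b hab => Finset.card_le_card ?_
  intro τ hτ
  rw [Finset.mem_filter] at hτ ⊢
  exact ⟨hτ.1, hτ.2.trans hab⟩

lemma ofReal_eq_sum_increments {s : ℕ → ℝ} (hs : Monotone s) (hs0 : s 0 = 0) {c m : ℕ}
    (hc : c ≤ m) :
    ENNReal.ofReal (s c) =
      ∑ k ∈ Finset.range m, ENNReal.ofReal (s (k + 1) - s k) * if k < c then 1 else 0 := by
  simp only [mul_ite, mul_one, mul_zero]
  rw [← Finset.sum_filter]
  have : (Finset.range m).filter (fun k => k < c) = Finset.range c := by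
    ext k
    simp only [Finset.mem_filter, Finset.mem_range]
    omega
  rw [this, ← ENNReal.ofReal_sum_of_nonneg fun k _ => sub_nonneg.2 (hs k.le_succ),
    Finset.sum_range_sub, hs0, sub_zero]

lemma setLIntegral_sum_mul_indicator_Ici (μ : Measure ℝ) [IsFiniteMeasure μ] (m : ℕ)
    {a : ℕ → ℝ} (ha : ∀ k, 0 ≤ a k) (r : ℕ → ℝ) (θ : ℝ) :
    ∫⁻ b in Set.Ici θ, ∑ k ∈ Finset.range m,
        ENNReal.ofReal (a k) * (if r k ≤ b then 1 else 0) ∂μ =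
      ENNReal.ofReal (∑ k ∈ Finset.range m, a k * μ.real (Set.Ici (max (r k) θ))) := by
  have hind : ∀ k, (fun b : ℝ => if r k ≤ b then (1 : ℝ≥0∞) else 0) =
      (Set.Ici (r k)).indicator 1 := by
    intro k
    ext b
    simp [Set.indicator_apply]
  have hmeas : ∀ k, Measurable fun b : ℝ => if r k ≤ b then (1 : ℝ≥0∞) else 0 := fun k => by
    rw [hind]
    exact measurable_one.indicator measurableSet_Ici
  rw [lintegral_finsetSum _ fun k _ => (hmeas k).const_mul _,
    ENNReal.ofReal_sum_of_nonneg fun k _ => mul_nonneg (ha k) measureReal_nonneg]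
  refine Finset.sum_congr rfl fun k _ => ?_
  rw [lintegral_const_mul _ (hmeas k), hind, lintegral_indicator_one measurableSet_Ici,
    Measure.restrict_apply measurableSet_Ici, Set.Ici_inter_Ici, ENNReal.ofReal_mul (ha k),
    ofReal_measureReal]

section SingleBidder

variable {μ : Measure ℝ} [IsProbabilityMeasure μ] {H : ℝ} {s p : ℕ → ℝ} {t : ℕ}

/-- The revenue of a posted price is at most the mass of the rounded-up virtual values. -/
lemma price_revenue_le_lintegral [NullSingletonClass μ] (hμ : μ (Set.Icc 1 H) = 1)
    (hs : Monotone s) (hs0 : s 0 = 0) (hst : H ≤ s t) (hp : Monotone p)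
    (hopt : ∀ k q, (q - s k) * μ.real (Set.Ici q) ≤ (p k - s k) * μ.real (Set.Ici (p k)))
    {θ : ℝ} (hθ : 0 ≤ θ) :
    ENNReal.ofReal θ * μ (Set.Ici θ) ≤
      ∫⁻ b in Set.Ici θ, ENNReal.ofReal (s (metCount p t b)) ∂μ := by
  have hend : ∀ q, (q - s t) * μ.real (Set.Ici q) ≤ 0 := by
    intro q
    rcases le_total H q with h | h
    · rw [measureReal_Ici_eq_zero hμ h, mul_zero]
    · exact mul_nonpos_of_nonpos_of_nonneg (by linarith) measureReal_nonneg
  have hanti : Antitone fun q => μ.real (Set.Ici q) := fun a b hab =>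
    measureReal_mono (Set.Ici_subset_Ici.2 hab)
  have hsum := mul_le_sum_of_optimal_prices hanti hs hs0 hopt hend θ
  have heq : ∀ b, ENNReal.ofReal (s (metCount p t b)) = ∑ k ∈ Finset.range t,
      ENNReal.ofReal (s (k + 1) - s k) * if p k ≤ b then 1 else 0 := by
    intro b
    rw [ofReal_eq_sum_increments hs hs0 (metCount_le p t b)]
    refine Finset.sum_congr rfl fun k hk => ?_
    simp only [lt_metCount_iff hp (Finset.mem_range.1 hk)]
  simp only [heq]
  rw [setLIntegral_sum_mul_indicator_Ici μ t (fun k => sub_nonneg.2 (hs k.le_succ)),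
    ← ofReal_measureReal (μ := μ) (s := Set.Ici θ), ← ENNReal.ofReal_mul hθ]
  exact ENNReal.ofReal_le_ofReal hsum

/-- The revenue of the optimal price `p k` is at least the mass of the rounded-down virtual
values. -/
lemma lintegral_le_price_revenue [NullSingletonClass μ] (hμ : μ (Set.Icc 1 H) = 1)
    (hs : Monotone s) (hs0 : s 0 = 0) (hp : Monotone p) (hp0 : ∀ k, 0 ≤ p k)
    (hopt : ∀ k q, (q - s k) * μ.real (Set.Ici q) ≤ (p k - s k) * μ.real (Set.Ici (p k)))
    {k : ℕ} (hk : k < t) :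
    ∫⁻ b in Set.Ici (p k), ENNReal.ofReal (s (metCount p t b - 1)) ∂μ ≤
      ENNReal.ofReal (p k) * μ (Set.Ici (p k)) := by
  have hsum := sum_le_mul_of_optimal_prices (G := fun q => μ.real (Set.Ici q)) hp hs0 hopt
    (measureReal_Ici_eq_zero hμ le_rfl) hk
  have heq : ∀ b, ENNReal.ofReal (s (metCount p t b - 1)) = ∑ l ∈ Finset.range (t - 1),
      ENNReal.ofReal (s (l + 1) - s l) * if p (l + 1) ≤ b then 1 else 0 := by
    intro b
    rw [ofReal_eq_sum_increments hs hs0 (Nat.sub_le_sub_right (metCount_le p t b) 1)]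
    refine Finset.sum_congr rfl fun l hl => ?_
    have hl' : l + 1 < t := by
      have := Finset.mem_range.1 hl
      omega
    simp only [← lt_metCount_iff hp hl', Nat.lt_sub_iff_add_lt]
  simp only [heq]
  rw [setLIntegral_sum_mul_indicator_Ici μ (t - 1) (fun l => sub_nonneg.2 (hs l.le_succ))
      (fun l => p (l + 1)),
    ← ofReal_measureReal (μ := μ) (s := Set.Ici (p k)), ← ENNReal.ofReal_mul (hp0 k)]
  exact ENNReal.ofReal_le_ofReal hsum

/-- Revenue bound for a single-bidder truthful mechanism with allocation `y` and payment `z`. -/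
lemma truthful_revenue_le_lintegral [NullSingletonClass μ] (hμ : μ (Set.Icc 1 H) = 1)
    (hs : Monotone s) (hs0 : s 0 = 0) (hst : H ≤ s t) (hp : Monotone p)
    (hopt : ∀ k q, (q - s k) * μ.real (Set.Ici q) ≤ (p k - s k) * μ.real (Set.Ici (p k)))
    {y z : ℝ → ℝ} (hy : ∀ b, y b = 0 ∨ y b = 1) (hz : ∀ b, 0 ≤ z b)
    (hir : ∀ b ∈ Set.Icc 1 H, z b ≤ b * y b)
    (hdsic : ∀ b ∈ Set.Icc 1 H, ∀ b' ∈ Set.Icc 1 H, b * y b' - z b' ≤ b * y b - z b) :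
    ∫⁻ b, ENNReal.ofReal (z b) ∂μ ≤ ∫⁻ b, ENNReal.ofReal (s (metCount p t b) * y b) ∂μ := by
  have hV := ae_mem_Icc_of_measure_eq_one hμ
  by_cases h : ∃ b₀ ∈ Set.Icc 1 H, y b₀ = 1
  · obtain ⟨b₀, hb₀, hy₀⟩ := h
    have hne : ∀ᵐ b ∂μ, b ≠ z b₀ := by simp [ae_iff]
    have hcases : ∀ b ∈ Set.Icc 1 H, b ≠ z b₀ →
        (y b = 1 ∧ z b = z b₀ ∧ z b₀ ≤ b) ∨ (y b = 0 ∧ z b = 0 ∧ ¬ z b₀ ≤ b) := by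
      intro b hb hbne
      have h1 := hdsic b hb b₀ hb₀
      have h2 := hdsic b₀ hb₀ b hb
      have h3 := hir b hb
      rw [hy₀] at h1 h2
      rcases hy b with h0 | h0 <;> rw [h0] at h1 h2 h3
      · have : z b = 0 := le_antisymm (by linarith) (hz b)
        refine Or.inr ⟨h0, this, fun hle => hbne (le_antisymm (by linarith) hle)⟩
      · have : z b = z b₀ := le_antisymm (by linarith) (by linarith)
        exact Or.inl ⟨h0, this, by linarith⟩
    have hz_eq : (fun b => ENNReal.ofReal (z b)) =ᵐ[μ]
        (Set.Ici (z b₀)).indicator fun _ => ENNReal.ofReal (z b₀) := by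
      filter_upwards [hV, hne] with b hb hbne
      rcases hcases b hb hbne with ⟨h1, h2, h3⟩ | ⟨h1, h2, h3⟩ <;>
        simp [h2, h3]
    have hy_eq : (fun b => ENNReal.ofReal (s (metCount p t b) * y b)) =ᵐ[μ]
        (Set.Ici (z b₀)).indicator fun b => ENNReal.ofReal (s (metCount p t b)) := by
      filter_upwards [hV, hne] with b hb hbne
      rcases hcases b hb hbne with ⟨h1, h2, h3⟩ | ⟨h1, h2, h3⟩ <;>
        simp [h1, h3]
    rw [lintegral_congr_ae hz_eq, lintegral_congr_ae hy_eq,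
      lintegral_indicator_const measurableSet_Ici, lintegral_indicator measurableSet_Ici]
    exact price_revenue_le_lintegral hμ hs hs0 hst hp hopt (hz b₀)
  · push Not at h
    have hz_eq : (fun b => ENNReal.ofReal (z b)) =ᵐ[μ] fun _ => 0 := by
      filter_upwards [hV] with b hb
      have h1 := hir b hb
      rw [(hy b).resolve_right (h b hb), mul_zero] at h1
      exact ENNReal.ofReal_of_nonpos h1
    rw [lintegral_congr_ae hz_eq, lintegral_zero]
    exact zero_le

end SingleBidder

/-- Bidder `i` wins when the bidders have met `c j` thresholds each. -/
def BeatsAll {n : ℕ} (succ : Fin n → Fin n → Prop) (c : Fin n → ℕ) (i : Fin n) : Prop :=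
  1 ≤ c i ∧ ∀ j, j ≠ i → (c j < c i ∨ (c j = c i ∧ succ i j))

lemma BeatsAll.update_mono {n : ℕ} {succ : Fin n → Fin n → Prop} {c : Fin n → ℕ} {i : Fin n}
    {a b : ℕ} (h : BeatsAll succ (Function.update c i a) i) (hab : a ≤ b) :
    BeatsAll succ (Function.update c i b) i := by
  obtain ⟨h1, h2⟩ := h
  rw [Function.update_self] at h1
  refine ⟨by rw [Function.update_self]; omega, fun j hj => ?_⟩
  have := h2 j hj
  rw [Function.update_self, Function.update_of_ne hj] at this ⊢
  rcases this with h | ⟨h, hs⟩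
  · exact Or.inl (by omega)
  · rcases hab.lt_or_eq with h' | h'
    · exact Or.inl (by omega)
    · exact Or.inr ⟨by omega, hs⟩

lemma exists_beatsAll {n : ℕ} (succ : Fin n → Fin n → Prop)
    (hsucc : IsStrictTotalOrder (Fin n) succ)
    {c : Fin n → ℕ} (hc : ∃ j, 1 ≤ c j) :
    ∃ w, BeatsAll succ c w ∧ ∀ j, c j ≤ c w := by
  obtain ⟨j₀, hj₀⟩ := hc
  obtain ⟨m, -, hm⟩ := Finset.exists_max_image Finset.univ c ⟨j₀, Finset.mem_univ _⟩
  obtain ⟨w, hw, hmin⟩ := (Finite.wellFounded_of_trans_of_irrefl succ).has_min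
    {j | c j = c m} ⟨m, rfl⟩
  have hmax : ∀ j, c j ≤ c w := fun j => (hm j (Finset.mem_univ _)).trans_eq hw.symm
  refine ⟨w, ⟨hj₀.trans (hmax j₀), fun j hj => ?_⟩, hmax⟩
  rcases (hmax j).lt_or_eq with h | h
  · exact Or.inl h
  · refine Or.inr ⟨h, ?_⟩
    rcases trichotomous_of succ w j with h' | h' | h'
    · exact h'
    · exact absurd h'.symm hj
    · exact absurd h' (hmin j (h.trans hw))

/-- Rounding virtual values down along a geometric grid and awarding the item to the bidder with
the highest level loses a factor `1 + δ` and an additive `δ`. -/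
lemma sum_rounded_up_le {n : ℕ} {succ : Fin n → Fin n → Prop}
    (hsucc : IsStrictTotalOrder (Fin n) succ) {s : ℕ → ℝ} (hs : Monotone s) (hs0 : s 0 = 0)
    {δ : ℝ} (hδ : 0 ≤ δ) (hstep : ∀ k, s (k + 1) = (1 + δ) * s k + δ) (c : Fin n → ℕ)
    {x : Fin n → ℝ} (hx : ∀ i, 0 ≤ x i) (hx1 : ∑ i, x i ≤ 1) :
    ∑ i, ENNReal.ofReal (s (c i) * x i) ≤
      ENNReal.ofReal (1 + δ) *
        ∑ i, (if BeatsAll succ c i then ENNReal.ofReal (s (c i - 1)) else 0) +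
      ENNReal.ofReal δ := by
  have hsnn : ∀ k, 0 ≤ s k := fun k => hs0 ▸ hs (Nat.zero_le k)
  by_cases hc : ∃ j, 1 ≤ c j
  · obtain ⟨w, hw, hmax⟩ := exists_beatsAll succ hsucc hc
    have h1 : ∑ i, s (c i) * x i ≤ (1 + δ) * s (c w - 1) + δ := by
      rw [← hstep, Nat.sub_add_cancel hw.1]
      calc ∑ i, s (c i) * x i ≤ ∑ i, s (c w) * x i :=
            Finset.sum_le_sum fun i _ => mul_le_mul_of_nonneg_right (hs (hmax i)) (hx i)
        _ = s (c w) * ∑ i, x i := by rw [Finset.mul_sum]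
        _ ≤ s (c w) := mul_le_of_le_one_right (hsnn _) hx1
    rw [← ENNReal.ofReal_sum_of_nonneg fun i _ => mul_nonneg (hsnn _) (hx i)]
    refine (ENNReal.ofReal_le_ofReal h1).trans ?_
    rw [ENNReal.ofReal_add (mul_nonneg (by linarith) (hsnn _)) hδ,
      ENNReal.ofReal_mul (by linarith : 0 ≤ 1 + δ)]
    gcongr
    have := Finset.single_le_sum (s := Finset.univ)
      (f := fun i => if BeatsAll succ c i then ENNReal.ofReal (s (c i - 1)) else 0)
      (fun i _ => zero_le) (Finset.mem_univ w)
    simpa only [if_pos hw] using this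
  · push Not at hc
    have h0 : ∀ i, c i = 0 := fun i => by
      have := hc i
      omega
    simp [h0, hs0]

/-- The multi-level auction with thresholds `p i 0 ≤ … ≤ p i (t - 1)`. -/
noncomputable def TLevel.ofPrices {n : ℕ} (t : ℕ) (p : Fin n → ℕ → ℝ) (hp : ∀ i, Monotone (p i)) :
    TLevel n t where
  thr i τ := p i τ
  mono i _ _ h := hp i h

section OfPrices

variable {n t : ℕ} {p : Fin n → ℕ → ℝ} (hp : ∀ i, Monotone (p i)) (succ : Fin n → Fin n → Prop)

lemma TLevel.ofPrices_wins_iff (v : Fin n → ℝ) (i : Fin n) :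
    (TLevel.ofPrices t p hp).wins succ v i ↔
      BeatsAll succ (fun j => metCount (p j) t (v j)) i := by
  have hlev : ∀ j, (TLevel.ofPrices t p hp).level j (v j) = (metCount (p j) t (v j) : ℤ) - 1 :=
    fun j => rfl
  unfold TLevel.wins BeatsAll
  simp only [hlev]
  refine and_congr (by omega) (forall_congr' fun j => imp_congr_right fun _ => ?_)
  refine or_congr (by omega) (and_congr_left fun _ => by omega)

lemma metCount_update (v : Fin n → ℝ) (i : Fin n) (b : ℝ) :
    (fun j => metCount (p j) t (Function.update v i b j)) =
      Function.update (fun j => metCount (p j) t (v j)) i (metCount (p i) t b) := by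
  ext j
  by_cases h : j = i
  · subst h
    simp
  · simp [h]

lemma TLevel.ofPrices_payment_eq (v : Fin n → ℝ) (i : Fin n) :
    (TLevel.ofPrices t p hp).payment succ v i =
      sInf {b : ℝ | BeatsAll succ (Function.update (fun j => metCount (p j) t (v j)) i
        (metCount (p i) t b)) i} := by
  unfold TLevel.payment
  simp only [TLevel.ofPrices_wins_iff, metCount_update]

lemma measurable_metCounts : Measurable fun (v : Fin n → ℝ) (j : Fin n) => metCount (p j) t (v j) :=
  measurable_pi_lambda _ fun j => (measurable_metCount (p j) t).comp (measurable_pi_apply j)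

lemma TLevel.measurable_ofPrices_revenue (i : Fin n) :
    Measurable fun v => if (TLevel.ofPrices t p hp).wins succ v i then
      ENNReal.ofReal ((TLevel.ofPrices t p hp).payment succ v i) else 0 := by
  simp only [TLevel.ofPrices_wins_iff, TLevel.ofPrices_payment_eq]
  exact (Measurable.of_discrete (f := fun c : Fin n → ℕ => if BeatsAll succ c i then
    ENNReal.ofReal (sInf {b : ℝ | BeatsAll succ (Function.update c i (metCount (p i) t b)) i})
    else 0)).comp measurable_metCounts

lemma measurable_rounded_down (s : ℕ → ℝ) (i : Fin n) :
    Measurable fun v : Fin n → ℝ => if BeatsAll succ (fun j => metCount (p j) t (v j)) i then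
      ENNReal.ofReal (s (metCount (p i) t (v i) - 1)) else 0 :=
  (Measurable.of_discrete (f := fun c : Fin n → ℕ => if BeatsAll succ c i then
    ENNReal.ofReal (s (c i - 1)) else 0)).comp measurable_metCounts

lemma TLevel.ofPrices_payment_nonneg (hp0 : ∀ i k, 0 ≤ p i k) (v : Fin n → ℝ) (i : Fin n) :
    0 ≤ (TLevel.ofPrices t p hp).payment succ v i := by
  rw [TLevel.ofPrices_payment_eq]
  refine Real.sInf_nonneg fun b hb => ?_
  have h1 := hb.1
  rw [Function.update_self] at h1
  have ht := h1.trans (metCount_le (p i) t b)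
  exact (hp0 i 0).trans ((lt_metCount_iff (hp i) ht).1 h1)

lemma TLevel.ofReal_ofPrices_rev (hp0 : ∀ i k, 0 ≤ p i k) (v : Fin n → ℝ) :
    ENNReal.ofReal ((TLevel.ofPrices t p hp).Rev succ v) =
      ∑ i, if (TLevel.ofPrices t p hp).wins succ v i then
        ENNReal.ofReal ((TLevel.ofPrices t p hp).payment succ v i) else 0 := by
  unfold TLevel.Rev
  rw [ENNReal.ofReal_sum_of_nonneg]
  · refine Finset.sum_congr rfl fun i _ => ?_
    split_ifs <;> simp
  · intro i _
    split_ifs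
    · exact TLevel.ofPrices_payment_nonneg hp succ hp0 v i
    · exact le_rfl

/-- For fixed competing bids, winning means meeting one of the thresholds. -/
lemma exists_winning_threshold (hp : ∀ i, Monotone (p i)) (succ : Fin n → Fin n → Prop)
    (x : Fin n → ℝ) (i : Fin n)
    (h : ∃ b, BeatsAll succ (Function.update (fun j => metCount (p j) t (x j)) i
        (metCount (p i) t b)) i) :
    ∃ k < t, ∀ b, BeatsAll succ (Function.update (fun j => metCount (p j) t (x j)) i
        (metCount (p i) t b)) i ↔ p i k ≤ b := by
  let W : ℕ → Prop := fun a =>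
    BeatsAll succ (Function.update (fun j => metCount (p j) t (x j)) i a) i
  obtain ⟨b₀, hb₀⟩ := h
  have hex : ∃ a, W a := ⟨_, hb₀⟩
  have hfind := Nat.find_spec hex
  have hpos : 1 ≤ Nat.find hex := by
    have := hfind.1
    rwa [Function.update_self] at this
  have hle : Nat.find hex ≤ t := (Nat.find_min' hex hb₀).trans (metCount_le _ _ _)
  have hlt : Nat.find hex - 1 < t := by omega
  refine ⟨Nat.find hex - 1, hlt, fun b => ?_⟩
  rw [← lt_metCount_iff (hp i) hlt]
  constructor
  · intro hb
    have := Nat.find_min' hex hb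
    omega
  · intro hb
    exact hfind.update_mono (by omega)

lemma TLevel.lintegral_rounded_down_le {Fi : Fin n → Measure ℝ} [∀ i, IsProbabilityMeasure (Fi i)]
    [∀ i, NullSingletonClass (Fi i)] {H : ℝ} (hF : ∀ i, Fi i (Set.Icc 1 H) = 1)
    {s : ℕ → ℝ} (hs : Monotone s) (hs0 : s 0 = 0) (hp0 : ∀ i k, 0 ≤ p i k)
    (hopt : ∀ i k q, (q - s k) * (Fi i).real (Set.Ici q) ≤
      (p i k - s k) * (Fi i).real (Set.Ici (p i k))) (i : Fin n) :
    ∫⁻ v, (if BeatsAll succ (fun j => metCount (p j) t (v j)) i then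
        ENNReal.ofReal (s (metCount (p i) t (v i) - 1)) else 0) ∂(Measure.pi Fi) ≤
      ∫⁻ v, (if (TLevel.ofPrices t p hp).wins succ v i then
        ENNReal.ofReal ((TLevel.ofPrices t p hp).payment succ v i) else 0) ∂(Measure.pi Fi) := by
  refine lintegral_le_of_lmarginal_le {i} (measurable_rounded_down succ s i)
    (TLevel.measurable_ofPrices_revenue hp succ i) ?_
  rw [lmarginal_singleton, lmarginal_singleton]
  intro x
  simp only [TLevel.ofPrices_wins_iff, TLevel.ofPrices_payment_eq, metCount_update,
    Function.update_self, Function.update_idem]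
  by_cases h : ∃ b, BeatsAll succ (Function.update (fun j => metCount (p j) t (x j)) i
        (metCount (p i) t b)) i
  · obtain ⟨k, hk, hiff⟩ := exists_winning_threshold hp succ x i h
    simp only [hiff]
    have hset : sInf {b : ℝ | p i k ≤ b} = p i k := csInf_Ici
    rw [hset]
    have e1 : (fun b => if p i k ≤ b then ENNReal.ofReal (s (metCount (p i) t b - 1)) else 0) =
        (Set.Ici (p i k)).indicator fun b => ENNReal.ofReal (s (metCount (p i) t b - 1)) := by
      ext b
      simp [Set.indicator_apply]
    have e2 : (fun b => if p i k ≤ b then ENNReal.ofReal (p i k) else 0) =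
        (Set.Ici (p i k)).indicator fun _ => ENNReal.ofReal (p i k) := by
      ext b
      simp [Set.indicator_apply]
    rw [e1, e2, lintegral_indicator measurableSet_Ici, lintegral_indicator_const measurableSet_Ici]
    exact lintegral_le_price_revenue (hF i) hs hs0 (hp i) (hp0 i) (hopt i) hk
  · push Not at h
    simp [h]

end OfPrices

/-- Coordinatewise truncation of a profile to `[1, H]`. -/
noncomputable def truncate {n : ℕ} (H : ℝ) (v : Fin n → ℝ) : Fin n → ℝ :=
  fun j => max 1 (min (v j) H)

lemma truncate_mem {n : ℕ} {H : ℝ} (hH : 1 ≤ H) (v : Fin n → ℝ) (j : Fin n) :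
    truncate H v j ∈ Set.Icc 1 H :=
  ⟨le_max_left _ _, max_le hH (min_le_right _ _)⟩

lemma truncate_update {n : ℕ} {H : ℝ} (v : Fin n → ℝ) (i : Fin n) {b : ℝ}
    (hb : b ∈ Set.Icc 1 H) :
    truncate H (Function.update v i b) = Function.update (truncate H v) i b := by
  ext j
  by_cases h : j = i
  · subst h
    simp [truncate, hb.1, hb.2]
  · simp [truncate, h]

lemma measurable_truncate {n : ℕ} (H : ℝ) : Measurable (truncate (n := n) H) :=
  measurable_pi_lambda _ fun j =>
    measurable_const.max ((measurable_pi_apply j).min measurable_const)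

section Mechanism

variable {n t : ℕ} {H : ℝ} {Fi : Fin n → Measure ℝ} [∀ i, IsProbabilityMeasure (Fi i)]

lemma truncate_ae_eq (hF : ∀ i, Fi i (Set.Icc 1 H) = 1) :
    ∀ᵐ v ∂(Measure.pi Fi), truncate H v = v := by
  have h : ∀ᵐ v ∂(Measure.pi Fi), ∀ j, v j ∈ Set.Icc 1 H :=
    Filter.eventually_all.2 fun j =>
      Measure.tendsto_eval_ae_ae.eventually (ae_mem_Icc_of_measure_eq_one (hF j))
  filter_upwards [h] with v hv
  ext j
  simp [truncate, (hv j).1, (hv j).2]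

/-- The expected payment of bidder `i` is at most her expected rounded-up virtual value on
winning. -/
lemma SIAuction.lintegral_pay_le [∀ i, NullSingletonClass (Fi i)] (M : SIAuction n (Set.Icc 1 H))
    (hH : 1 ≤ H) (hF : ∀ i, Fi i (Set.Icc 1 H) = 1) {s : ℕ → ℝ} (hs : Monotone s) (hs0 : s 0 = 0)
    (hst : H ≤ s t) {p : Fin n → ℕ → ℝ} (hp : ∀ i, Monotone (p i))
    (hopt : ∀ i k q, (q - s k) * (Fi i).real (Set.Ici q) ≤
      (p i k - s k) * (Fi i).real (Set.Ici (p i k))) (i : Fin n) :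
    ∫⁻ v, ENNReal.ofReal (M.pay v i) ∂(Measure.pi Fi) ≤
      ∫⁻ v, ENNReal.ofReal (s (metCount (p i) t (v i)) * M.alloc (truncate H v) i)
        ∂(Measure.pi Fi) := by
  have hcongr : ∫⁻ v, ENNReal.ofReal (M.pay v i) ∂(Measure.pi Fi) =
      ∫⁻ v, ENNReal.ofReal (M.pay (truncate H v) i) ∂(Measure.pi Fi) := by
    refine lintegral_congr_ae ?_
    filter_upwards [truncate_ae_eq hF] with v hv
    rw [hv]
  rw [hcongr]
  refine lintegral_le_of_lmarginal_le {i}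
    ((M.pay_meas i).comp (measurable_truncate H)).ennreal_ofReal
    (((Measurable.of_discrete (f := s)).comp ((measurable_metCount (p i) t).comp
      (measurable_pi_apply i))).mul
      ((M.alloc_meas i).comp (measurable_truncate H))).ennreal_ofReal ?_
  rw [lmarginal_singleton, lmarginal_singleton]
  intro x
  simp only [Function.update_self]
  have hmem : ∀ b ∈ Set.Icc 1 H, ∀ j, Function.update (truncate H x) i b j ∈ Set.Icc 1 H := by
    intro b hb j
    rw [← truncate_update x i hb]
    exact truncate_mem hH _ j
  refine truthful_revenue_le_lintegral (hF i) hs hs0 hst (hp i) (hopt i)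
    (y := fun b => M.alloc (truncate H (Function.update x i b)) i)
    (z := fun b => M.pay (truncate H (Function.update x i b)) i)
    (fun b => M.alloc01 _ i) (fun b => M.pay_nonneg _ i) ?_ ?_
  · intro b hb
    have := M.pay_le _ (hmem b hb) i
    rw [Function.update_self] at this
    rwa [truncate_update x i hb]
  · intro b hb b' hb'
    have := M.dsic _ (hmem b hb) i b' hb'
    rw [Function.update_self, Function.update_idem] at this
    simp only [truncate_update x i hb, truncate_update x i hb']
    exact this

lemma SIAuction.lintegral_pay_le_rev [∀ i, NullSingletonClass (Fi i)]
    (M : SIAuction n (Set.Icc 1 H)) {succ : Fin n → Fin n → Prop}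
    (hsucc : IsStrictTotalOrder (Fin n) succ)
    (hH : 1 ≤ H) (hF : ∀ i, Fi i (Set.Icc 1 H) = 1) {s : ℕ → ℝ} (hs : Monotone s) (hs0 : s 0 = 0)
    {δ : ℝ} (hδ : 0 ≤ δ) (hstep : ∀ k, s (k + 1) = (1 + δ) * s k + δ)
    (hst : H ≤ s t) {p : Fin n → ℕ → ℝ} (hp : ∀ i, Monotone (p i)) (hp0 : ∀ i k, 0 ≤ p i k)
    (hopt : ∀ i k q, (q - s k) * (Fi i).real (Set.Ici q) ≤
      (p i k - s k) * (Fi i).real (Set.Ici (p i k))) :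
    ∫⁻ v, ∑ i, ENNReal.ofReal (M.pay v i) ∂(Measure.pi Fi) ≤
      ENNReal.ofReal (1 + δ) *
        ∫⁻ v, ENNReal.ofReal ((TLevel.ofPrices t p hp).Rev succ v) ∂(Measure.pi Fi) +
      ENNReal.ofReal δ := by
  calc ∫⁻ v, ∑ i, ENNReal.ofReal (M.pay v i) ∂(Measure.pi Fi)
      = ∑ i, ∫⁻ v, ENNReal.ofReal (M.pay v i) ∂(Measure.pi Fi) :=
        lintegral_finsetSum _ fun i _ => (M.pay_meas i).ennreal_ofReal
    _ ≤ ∑ i, ∫⁻ v, ENNReal.ofReal (s (metCount (p i) t (v i)) * M.alloc (truncate H v) i)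
          ∂(Measure.pi Fi) :=
        Finset.sum_le_sum fun i _ => M.lintegral_pay_le hH hF hs hs0 hst hp hopt i
    _ = ∫⁻ v, ∑ i, ENNReal.ofReal (s (metCount (p i) t (v i)) * M.alloc (truncate H v) i)
          ∂(Measure.pi Fi) :=
        (lintegral_finsetSum _ fun i _ => (((Measurable.of_discrete (f := s)).comp
          ((measurable_metCount (p i) t).comp (measurable_pi_apply i))).mul
          ((M.alloc_meas i).comp (measurable_truncate H))).ennreal_ofReal).symm
    _ ≤ ∫⁻ v, (ENNReal.ofReal (1 + δ) *
          (∑ i, if BeatsAll succ (fun j => metCount (p j) t (v j)) i then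
            ENNReal.ofReal (s (metCount (p i) t (v i) - 1)) else 0) +
          ENNReal.ofReal δ) ∂(Measure.pi Fi) := by
        refine lintegral_mono fun v => ?_
        refine sum_rounded_up_le hsucc hs hs0 hδ hstep (fun j => metCount (p j) t (v j))
          (fun i => ?_) (M.feas _)
        rcases M.alloc01 (truncate H v) i with h | h <;> simp [h]
    _ = ENNReal.ofReal (1 + δ) * (∑ i, ∫⁻ v,
          (if BeatsAll succ (fun j => metCount (p j) t (v j)) i then
            ENNReal.ofReal (s (metCount (p i) t (v i) - 1)) else 0) ∂(Measure.pi Fi)) +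
          ENNReal.ofReal δ := by
        have hm := fun i => measurable_rounded_down (t := t) (p := p) succ s i
        rw [lintegral_add_right _ measurable_const,
          lintegral_const_mul _ (Finset.measurable_fun_sum _ fun i _ => hm i),
          lintegral_finsetSum _ fun i _ => hm i, lintegral_const, measure_univ, mul_one]
    _ ≤ ENNReal.ofReal (1 + δ) * (∑ i, ∫⁻ v, (if (TLevel.ofPrices t p hp).wins succ v i then
        ENNReal.ofReal ((TLevel.ofPrices t p hp).payment succ v i) else 0) ∂(Measure.pi Fi)) +
          ENNReal.ofReal δ := by
        refine add_le_add_left (mul_le_mul_right (Finset.sum_le_sum fun i _ => ?_) _) _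
        exact TLevel.lintegral_rounded_down_le hp succ hF hs hs0 hp0 hopt i
    _ = _ := by
        rw [← lintegral_finsetSum _ fun i _ => TLevel.measurable_ofPrices_revenue hp succ i]
        simp only [TLevel.ofReal_ofPrices_rev hp succ hp0]

/-- Selling to bidder `i₀` at price `1`. -/
noncomputable def SIAuction.unitPrice (i₀ : Fin n) (H : ℝ) : SIAuction n (Set.Icc 1 H) where
  alloc _ i := if i = i₀ then 1 else 0
  pay _ i := if i = i₀ then 1 else 0
  alloc_meas _ := measurable_const
  pay_meas _ := measurable_const
  alloc01 _ i := by
    by_cases h : i = i₀ <;> simp [h]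
  feas _ := by simp
  pay_nonneg _ i := by
    by_cases h : i = i₀ <;> simp [h]
  pay_le v hv i := by
    by_cases h : i = i₀
    · simpa [h] using (hv i₀).1
    · simp [h]
  dsic _ _ _ _ _ := le_rfl

lemma one_le_OPT (i₀ : Fin n) : 1 ≤ OPT n (Set.Icc 1 H) (Measure.pi Fi) := by
  refine le_trans (le_of_eq ?_) (le_iSup _ (SIAuction.unitPrice i₀ H))
  have h : ∀ v, ∑ i, ENNReal.ofReal ((SIAuction.unitPrice i₀ H).pay v i) = 1 := by
    intro v
    simp [SIAuction.unitPrice, apply_ite ENNReal.ofReal]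
  simp [h]

end Mechanism

lemma one_sub_mul_le_of_le_add {O R : ℝ≥0∞} {ε : ℝ} (hε : ε ∈ Set.Ioo (0 : ℝ) 1) (hO : 1 ≤ O)
    (h : O ≤ ENNReal.ofReal (1 + ε / 2) * R + ENNReal.ofReal (ε / 2)) :
    ENNReal.ofReal (1 - ε) * O ≤ R := by
  obtain ⟨h0, h1⟩ := hε
  by_cases hR : R = ⊤
  · rw [hR]
    exact le_top
  lift R to NNReal using hR
  have hO' : O ≠ ⊤ := ne_top_of_le_ne_top (by finiteness) h
  lift O to NNReal using hO'
  rw [← ENNReal.ofReal_coe_nnreal (p := R), ← ENNReal.ofReal_coe_nnreal (p := O)] at *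
  rw [← ENNReal.ofReal_mul (by linarith), ← ENNReal.ofReal_add (by positivity) (by positivity),
    ENNReal.ofReal_le_ofReal_iff (by positivity)] at h
  rw [ENNReal.one_le_ofReal] at hO
  rw [← ENNReal.ofReal_mul (by linarith)]
  refine ENNReal.ofReal_le_ofReal ?_
  have h2 : (1 - ε) * ((1 + ε / 2) * (O : ℝ)) ≤ (1 + ε / 2) * R := by
    have e1 : 0 ≤ ε * ε * (O : ℝ) := by positivity
    have e2 : 0 ≤ ε * ((O : ℝ) - 1) := mul_nonneg h0.le (by linarith)
    nlinarith
  nlinarith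

lemma le_geometric_grid {H ε : ℝ} (hH : 1 ≤ H) (hε : ε ∈ Set.Ioo (0 : ℝ) 1) {t : ℕ}
    (ht : 3 * (1 / ε + Real.log H / Real.log (1 + ε)) ≤ t) : H ≤ (1 + ε / 2) ^ t - 1 := by
  obtain ⟨h0, h1⟩ := hε
  set L := Real.log (1 + ε) with hL
  have hLε : ε / 2 ≤ L := by
    have h := Real.one_sub_inv_le_log_of_pos (by linarith : 0 < 1 + ε)
    have h' : ε / 2 ≤ 1 - (1 + ε)⁻¹ := by
      rw [inv_eq_one_div, le_sub_iff_add_le, ← le_sub_iff_add_le', div_le_iff₀ (by linarith)]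
      nlinarith
    linarith
  have hLpos : 0 < L := by linarith
  have hhalf : L / 2 ≤ Real.log (1 + ε / 2) := by
    have h : L ≤ Real.log ((1 + ε / 2) ^ 2) := Real.log_le_log (by linarith) (by nlinarith)
    rw [Real.log_pow] at h
    push_cast at h
    linarith
  have hlog : Real.log 2 + Real.log H ≤ t * Real.log (1 + ε / 2) := by
    have hHlog := Real.log_nonneg hH
    have e1 : (3 * (1 / ε + Real.log H / L)) * (L / 2) = 3 / 2 * (L / ε + Real.log H) := by
      field_simp
    have e2 : 1 / 2 ≤ L / ε := by
      rw [le_div_iff₀ h0]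
      linarith
    have e3 : (3 * (1 / ε + Real.log H / L)) * (L / 2) ≤ t * Real.log (1 + ε / 2) :=
      mul_le_mul ht hhalf (by positivity) (by positivity)
    have := Real.log_two_lt_d9
    linarith
  rw [← Real.log_mul (by norm_num) (by linarith), ← Real.log_pow] at hlog
  have := (Real.log_le_log_iff (by linarith) (by positivity)).1 hlog
  linarith

/-- Representation error of `t`-level single-item auctions for bounded product
distributions: there is a universal constant `c > 0` such that for every product
distribution with atomless marginals supported in `[1,H]` and every
`t ≥ c (1/ε + ln H / ln(1+ε))`, some `t`-level auction earns expected revenue at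
least `(1-ε)` times the optimal revenue. -/
theorem representation_error_tlevel_single_item :
    ∃ c : ℝ, 0 < c ∧
      ∀ n : ℕ, 1 ≤ n →
      ∀ H : ℝ, 1 ≤ H →
      ∀ ε : ℝ, ε ∈ Set.Ioo (0 : ℝ) 1 →
      ∀ Fi : Fin n → Measure ℝ,
        (∀ i, IsProbabilityMeasure (Fi i)) →
        (∀ i, ∀ x : ℝ, Fi i {x} = 0) →
        (∀ i, Fi i (Set.Icc 1 H) = 1) →
      ∀ t : ℕ, c * (1 / ε + Real.log H / Real.log (1 + ε)) ≤ t →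
      ∀ succ : Fin n → Fin n → Prop, IsStrictTotalOrder (Fin n) succ →
      ∃ A : TLevel n t,
        ENNReal.ofReal (1 - ε) * OPT n (Set.Icc 1 H) (Measure.pi Fi) ≤
          ∫⁻ v, ENNReal.ofReal (A.Rev succ v) ∂(Measure.pi Fi) := by
  refine ⟨3, by norm_num, ?_⟩
  intro n hn H hH ε hε Fi hprob hatom hF t ht succ hsucc
  have : ∀ i, NullSingletonClass (Fi i) := fun i => ⟨hatom i⟩
  have hε0 : 0 < ε := hε.1
  set s : ℕ → ℝ := fun k => (1 + ε / 2) ^ k - 1 with hs_def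
  have hs : Monotone s := fun a b hab =>
    sub_le_sub_right (pow_le_pow_right₀ (by linarith) hab) 1
  have hs0 : s 0 = 0 := by simp [hs_def]
  have hstep : ∀ k, s (k + 1) = (1 + ε / 2) * s k + ε / 2 := fun k => by
    simp only [hs_def]
    ring
  choose p hp hpH hopt using fun i => exists_monotone_optimal_prices hH (hF i) hs
  have hp0 : ∀ i k, 0 ≤ p i k := fun i k => zero_le_one.trans (hpH i k).1
  refine ⟨TLevel.ofPrices t p hp, one_sub_mul_le_of_le_add hε (one_le_OPT ⟨0, hn⟩) ?_⟩
  exact iSup_le fun M => M.lintegral_pay_le_rev hsucc hH hF hs hs0 (by positivity) hstep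
    (le_geometric_grid hH hε ht) hp hp0 hopt
end
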